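/- Let G be a connected simple graph of order n such that n is a Laplacian eigenvalue of G with multiplicity exactly 2. Then G = F ∨ H where F is itself a join of two graphs and H is not a join of two graphs. -/

import Mathlib

open SimpleGraph Polynomial

/-- The multiset of Laplacian eigenvalues (roots of the characteristic polynomial of the
Laplacian matrix over `ℝ`, with multiplicity) of a simple graph. -/
noncomputable def lapSpec {V : Type*} [Fintype V] [DecidableEq V] (G : SimpleGraph V) :
    Multiset ℝ :=
  letI := Classical.decRel G.Adj
  ((G.lapMatrix ℝ).charpoly).roots

/-- The disjoint union of two simple graphs. -/
def graphUnion {α β : Type*} (G : SimpleGraph α) (H : SimpleGraph β) : SimpleGraph (α ⊕ β) :=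
  SimpleGraph.fromRel fun x y =>
    (∃ a b, x = Sum.inl a ∧ y = Sum.inl b ∧ G.Adj a b) ∨
    (∃ a b, x = Sum.inr a ∧ y = Sum.inr b ∧ H.Adj a b)

/-- The join of two simple graphs: the disjoint union together with all edges between the parts. -/
def graphJoin {α β : Type*} (G : SimpleGraph α) (H : SimpleGraph β) : SimpleGraph (α ⊕ β) :=
  SimpleGraph.fromRel fun x y =>
    (∃ a b, x = Sum.inl a ∧ y = Sum.inl b ∧ G.Adj a b) ∨
    (∃ a b, x = Sum.inr a ∧ y = Sum.inr b ∧ H.Adj a b) ∨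
    (∃ a b, x = Sum.inl a ∧ y = Sum.inr b)

/-- `G` is a join of two nonempty graphs. -/
def IsJoin {γ : Type*} [Fintype γ] (G : SimpleGraph γ) : Prop :=
  ∃ (p q : ℕ) (F : SimpleGraph (Fin p)) (H : SimpleGraph (Fin q)),
    0 < p ∧ 0 < q ∧ Nonempty (G ≃g graphJoin F H)

/-- The multiset `S_{{i,j},n}^m`: the integers `0,1,…,n` with `i` and `j` removed and an extra
copy of `m` added (so `m` is counted twice), viewed as a multiset of reals. -/
def Sdouble (i j n m : ℕ) : Multiset ℝ :=
  ((m ::ₘ (((Finset.range (n + 1)).val.erase i).erase j)).map (fun k : ℕ => (k : ℝ)))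

/-- The multiset `S_{j,n} = {0,1,…,n} \ {j}`, viewed as a multiset of reals. -/
def Ssingle (j n : ℕ) : Multiset ℝ :=
  (((Finset.range (n + 1)).val.erase j).map (fun k : ℕ => (k : ℝ)))

/-- The one-vertex graph `K₁`. -/
def K1 : SimpleGraph (Fin 1) := ⊥

/-- The complete graph `K₂` on two vertices. -/
def K2 : SimpleGraph (Fin 2) := ⊤

/-- The algebraic multiplicity of an eigenvalue of a Hermitian real matrix is the dimension of
its eigenspace. -/
lemma Matrix.IsHermitian.count_roots_charpoly {n : Type*} [Fintype n] [DecidableEq n]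
    {A : Matrix n n ℝ} (hA : A.IsHermitian) (μ : ℝ) :
    A.charpoly.roots.count μ = Module.finrank ℝ (Module.End.eigenspace (Matrix.toLin' A) μ) := by
  have hT := Matrix.isSymmetric_toEuclideanLin_iff.2 hA
  have hchar : (Matrix.toEuclideanLin A).charpoly = A.charpoly := by
    rw [Matrix.toEuclideanLin_eq_toLin_orthonormal, Matrix.charpoly_toLin]
  have hmap : (Module.End.eigenspace (Matrix.toEuclideanLin A) μ).map
      (WithLp.linearEquiv 2 ℝ (n → ℝ)).toLinearMap =
        Module.End.eigenspace (Matrix.toLin' A) μ := by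
    ext x
    simp only [Submodule.mem_map, Module.End.mem_eigenspace_iff]
    constructor
    · rintro ⟨y, hy, rfl⟩
      simpa using congrArg WithLp.ofLp hy
    · intro hx
      exact ⟨WithLp.toLp 2 x, by
        simpa using congrArg (WithLp.toLp 2) hx, rfl⟩
  rw [Polynomial.count_roots, ← hchar, ← LinearMap.finrank_maxGenEigenspace_eq,
    hT.isFinitelySemisimple.maxGenEigenspace_eq_eigenspace, ← hmap]
  exact (LinearEquiv.finrank_map_eq _ _).symm

namespace SimpleGraph

section Laplacian

variable {V : Type*} [Fintype V] [DecidableEq V] (G : SimpleGraph V) [DecidableRel G.Adj]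

lemma lapMatrix_mulVec_add_lapMatrix_compl_mulVec (x : V → ℝ) (v : V) :
    (G.lapMatrix ℝ).mulVec x v + (Gᶜ.lapMatrix ℝ).mulVec x v =
      Fintype.card V * x v - ∑ u, x u := by
  have hsum : ∑ u, x u =
      x v + ∑ u ∈ G.neighborFinset v, x u + ∑ u ∈ Gᶜ.neighborFinset v, x u := by
    rw [neighborFinset_compl, add_assoc, ← Finset.sum_union (by
      rw [Finset.disjoint_left]; simp +contextual), ← Finset.sum_insert (by simp)]
    congr 1
    ext u
    by_cases h : u = v <;> by_cases h' : G.Adj v u <;> simp [h, h']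
  have hdeg : (Fintype.card V : ℝ) = 1 + G.degree v + Gᶜ.degree v := by
    have h := G.degree_lt_card_verts v
    rw [degree_compl]
    norm_cast
    omega
  rw [lapMatrix_mulVec_apply, lapMatrix_mulVec_apply, hsum, hdeg]
  ring

lemma sum_lapMatrix_mulVec (x : V → ℝ) : ∑ v, (G.lapMatrix ℝ).mulVec x v = 0 := by
  have h := Matrix.dotProduct_mulVec (fun _ : V ↦ (1 : ℝ)) (G.lapMatrix ℝ) x
  rw [← Matrix.mulVec_transpose, (G.isSymm_lapMatrix ℝ).eq, lapMatrix_mulVec_const_eq_zero,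
    zero_dotProduct] at h
  simpa [dotProduct] using h

/-- The eigenspace of the Laplacian for the number of vertices consists of the vectors with zero
coordinate sum in the kernel of the Laplacian of the complement. -/
lemma mem_eigenspace_card_lapMatrix_iff [Nonempty V] (x : V → ℝ) :
    x ∈ Module.End.eigenspace (Matrix.toLin' (G.lapMatrix ℝ)) (Fintype.card V : ℝ) ↔
      (Gᶜ.lapMatrix ℝ).mulVec x = 0 ∧ ∑ v, x v = 0 := by
  have hcard : (Fintype.card V : ℝ) ≠ 0 := by simp
  rw [Module.End.mem_eigenspace_iff, Matrix.toLin'_apply]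
  constructor
  · intro h
    have hsum : ∑ v, x v = 0 := by
      have h0 := G.sum_lapMatrix_mulVec x
      rw [h] at h0
      simpa [← Finset.mul_sum] using h0
    refine ⟨funext fun v ↦ ?_, hsum⟩
    have := G.lapMatrix_mulVec_add_lapMatrix_compl_mulVec x v
    rw [h, hsum] at this
    simpa using this
  · rintro ⟨h, hsum⟩
    funext v
    have := G.lapMatrix_mulVec_add_lapMatrix_compl_mulVec x v
    rw [h, hsum] at this
    simpa using this

lemma finrank_eigenspace_card_lapMatrix_add_one [Nonempty V] :
    Module.finrank ℝ (Module.End.eigenspace (Matrix.toLin' (G.lapMatrix ℝ))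
      (Fintype.card V : ℝ)) + 1 = Nat.card Gᶜ.ConnectedComponent := by
  classical
  rw [Nat.card_eq_fintype_card, card_connectedComponent_eq_finrank_ker_toLin'_lapMatrix]
  set K := LinearMap.ker (Matrix.toLin' (Gᶜ.lapMatrix ℝ))
  let s : K →ₗ[ℝ] ℝ := (∑ v, LinearMap.proj v : (V → ℝ) →ₗ[ℝ] ℝ) ∘ₗ K.subtype
  have hs (x : K) : s x = ∑ v, (x : V → ℝ) v := by simp [s]
  have hone : (fun _ ↦ 1 : V → ℝ) ∈ K := by
    rw [LinearMap.mem_ker, Matrix.toLin'_apply, lapMatrix_mulVec_const_eq_zero]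
  have hrange : LinearMap.range s = ⊤ := by
    refine LinearMap.range_eq_top.2 (LinearMap.surjective fun h ↦ ?_)
    have := hs ⟨_, hone⟩
    simp [h, eq_comm] at this
  have hker : (LinearMap.ker s).map K.subtype =
      Module.End.eigenspace (Matrix.toLin' (G.lapMatrix ℝ)) (Fintype.card V : ℝ) := by
    ext x
    rw [mem_eigenspace_card_lapMatrix_iff]
    constructor
    · rintro ⟨y, hy, rfl⟩
      exact ⟨y.2, (hs y).symm.trans hy⟩
    · rintro ⟨hx, hsum⟩
      exact ⟨⟨x, hx⟩, (hs _).trans hsum, rfl⟩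
  rw [← hker, Submodule.finrank_map_subtype_eq, ← s.finrank_range_add_finrank_ker, hrange,
    finrank_top, Module.finrank_self, add_comm]

end Laplacian

end SimpleGraph

lemma count_lapSpec_card_add_one {V : Type*} [Fintype V] [DecidableEq V] [Nonempty V]
    (G : SimpleGraph V) :
    (lapSpec G).count (Fintype.card V : ℝ) + 1 = Nat.card Gᶜ.ConnectedComponent := by
  classical
  rw [lapSpec, (G.isHermitian_lapMatrix ℝ).count_roots_charpoly,
    G.finrank_eigenspace_card_lapMatrix_add_one]

lemma graphJoin_adj_inl_inl {α β : Type*} (F : SimpleGraph α) (H : SimpleGraph β) (a b : α) :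
    (graphJoin F H).Adj (Sum.inl a) (Sum.inl b) ↔ F.Adj a b := by
  simp only [graphJoin, SimpleGraph.fromRel_adj]
  have := F.ne_of_adj (a := a) (b := b)
  have := F.adj_comm a b
  aesop

lemma graphJoin_adj_inr_inr {α β : Type*} (F : SimpleGraph α) (H : SimpleGraph β) (a b : β) :
    (graphJoin F H).Adj (Sum.inr a) (Sum.inr b) ↔ H.Adj a b := by
  simp only [graphJoin, SimpleGraph.fromRel_adj]
  have := H.ne_of_adj (a := a) (b := b)
  have := H.adj_comm a b
  aesop

lemma graphJoin_adj_inl_inr {α β : Type*} (F : SimpleGraph α) (H : SimpleGraph β) (a : α)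
    (b : β) : (graphJoin F H).Adj (Sum.inl a) (Sum.inr b) := by
  simp [graphJoin]

/-- A graph in which every vertex of `s` is adjacent to every vertex outside `s` is the join of
the two induced subgraphs. -/
lemma exists_iso_graphJoin {γ : Type*} [Fintype γ] (G : SimpleGraph γ) {s : Set γ}
    (hs : s.Nonempty) (hsc : sᶜ.Nonempty) (hadj : ∀ x ∈ s, ∀ y ∉ s, G.Adj x y) :
    ∃ (p q : ℕ) (F : SimpleGraph (Fin p)) (H : SimpleGraph (Fin q)),
      0 < p ∧ 0 < q ∧ Nonempty (G ≃g graphJoin F H) ∧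
        Nonempty (F ≃g G.induce s) ∧ Nonempty (H ≃g G.induce sᶜ) := by
  classical
  let e : s ≃ Fin (Fintype.card s) := Fintype.equivFin s
  let f : ↥sᶜ ≃ Fin (Fintype.card ↥sᶜ) := Fintype.equivFin ↥sᶜ
  have : Nonempty s := hs.to_subtype
  have : Nonempty ↥sᶜ := hsc.to_subtype
  let E : s ⊕ ↥sᶜ ≃ γ := Equiv.Set.sumCompl s
  refine ⟨_, _, (G.induce s).comap e.symm, (G.induce sᶜ).comap f.symm, Fintype.card_pos,
    Fintype.card_pos, ⟨⟨E.symm.trans (e.sumCongr f), ?_⟩⟩, ⟨⟨e.symm, Iff.rfl⟩⟩,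
    ⟨⟨f.symm, Iff.rfl⟩⟩⟩
  intro a b
  obtain ⟨a, rfl⟩ := E.surjective a
  obtain ⟨b, rfl⟩ := E.surjective b
  rcases a with a | a <;> rcases b with b | b
  · simp [graphJoin_adj_inl_inl, E]
  · simpa [graphJoin_adj_inl_inr, E] using hadj a a.2 b b.2
  · simpa [(graphJoin_adj_inl_inr _ _ _ _).symm, E] using (hadj b b.2 a a.2).symm
  · simp [graphJoin_adj_inr_inr, E]

lemma isJoin_iff {γ : Type*} [Fintype γ] (G : SimpleGraph γ) :
    IsJoin G ↔ ∃ s : Set γ, s.Nonempty ∧ sᶜ.Nonempty ∧ ∀ x ∈ s, ∀ y ∉ s, G.Adj x y := by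
  constructor
  · rintro ⟨p, q, F, H, hp, hq, ⟨e⟩⟩
    refine ⟨{x | (e x).isLeft}, ⟨e.symm (Sum.inl ⟨0, hp⟩), by simp⟩,
      ⟨e.symm (Sum.inr ⟨0, hq⟩), by simp⟩, fun x hx y hy ↦ e.map_adj_iff.1 ?_⟩
    obtain ⟨a, ha⟩ := Sum.isLeft_iff.1 hx
    obtain ⟨b, hb⟩ := Sum.isRight_iff.1 (Sum.not_isLeft.1 hy)
    rw [ha, hb]
    exact graphJoin_adj_inl_inr F H a b
  · rintro ⟨s, hs, hsc, hadj⟩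
    obtain ⟨p, q, F, H, hp, hq, h, -⟩ := exists_iso_graphJoin G hs hsc hadj
    exact ⟨p, q, F, H, hp, hq, h⟩

lemma IsJoin.of_iso {γ δ : Type*} [Fintype γ] [Fintype δ] {G : SimpleGraph γ}
    {G' : SimpleGraph δ} (e : G ≃g G') (h : IsJoin G') : IsJoin G := by
  obtain ⟨p, q, F, H, hp, hq, ⟨f⟩⟩ := h
  exact ⟨p, q, F, H, hp, hq, ⟨e.trans f⟩⟩

/-- The subgraph induced on a connected component of the complement is not a join. -/
lemma not_isJoin_induce_supp_compl {V : Type*} [Fintype V] (G : SimpleGraph V)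
    (c : Gᶜ.ConnectedComponent) [Fintype c.supp] : ¬ IsJoin (G.induce c.supp) := by
  rw [isJoin_iff]
  rintro ⟨s, ⟨x, hx⟩, ⟨y, hy⟩, hadj⟩
  have hclosed : ∀ u v, Gᶜ.Reachable u v → u ∈ Subtype.val '' s → v ∈ Subtype.val '' s := by
    rintro u v ⟨w⟩ hu
    induction w with
    | nil => exact hu
    | @cons u v w huv _ ih =>
      obtain ⟨u, hus, rfl⟩ := hu
      have hv : v ∈ c.supp := (c.mem_supp_congr_adj huv).1 u.2
      refine ih ⟨⟨v, hv⟩, ?_, rfl⟩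
      by_contra hvs
      exact ((SimpleGraph.compl_adj _ _ _).1 huv).2 (hadj u hus ⟨v, hv⟩ hvs)
  obtain ⟨z, hz, hzy⟩ := hclosed x y
    (SimpleGraph.ConnectedComponent.exact (x.2.trans y.2.symm)) ⟨x, hx, rfl⟩
  exact hy (Subtype.ext hzy ▸ hz)

/-- If `n` is a Laplacian eigenvalue of the connected graph `G` of order `n` with multiplicity
exactly `2`, then `G = F ∨ H` where `F` is itself a join while `H` is not a join. -/
theorem join_structure_of_double_card_eigenvalue {V : Type*} [Fintype V] [DecidableEq V]
    (G : SimpleGraph V) (hG : G.Connected)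
    (h2 : (lapSpec G).count (Fintype.card V : ℝ) = 2) :
    ∃ (p q : ℕ) (F : SimpleGraph (Fin p)) (H : SimpleGraph (Fin q)),
      0 < p ∧ 0 < q ∧ Nonempty (G ≃g graphJoin F H) ∧ IsJoin F ∧ ¬ IsJoin H := by
  classical
  have := hG.nonempty
  have hcard : Nat.card Gᶜ.ConnectedComponent = 3 := by
    rw [← count_lapSpec_card_add_one, h2]
  obtain ⟨a, b, c, hab, hac, hbc, -⟩ := Finset.card_eq_three.1
    (show (Finset.univ : Finset Gᶜ.ConnectedComponent).card = 3 by
      rw [Finset.card_univ, ← Nat.card_eq_fintype_card, hcard])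
  have hadj {u v : V}
      (h : Gᶜ.connectedComponentMk u ≠ Gᶜ.connectedComponentMk v) : G.Adj u v := by
    by_contra huv
    refine h (SimpleGraph.ConnectedComponent.connectedComponentMk_eq_of_adj ?_)
    exact (SimpleGraph.compl_adj _ _ _).2 ⟨fun huv ↦ h (huv ▸ rfl), huv⟩
  obtain ⟨x, hx⟩ := a.nonempty_supp
  obtain ⟨y, hy⟩ := b.nonempty_supp
  rw [SimpleGraph.ConnectedComponent.mem_supp_iff] at hx hy
  obtain ⟨p, q, F, H, hp, hq, hGFH, ⟨eF⟩, ⟨eH⟩⟩ := exists_iso_graphJoin G (s := c.suppᶜ)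
    ⟨x, fun h ↦ hac (hx.symm.trans h)⟩ (by simpa using c.nonempty_supp)
    (fun u hu v hv ↦ hadj fun huv ↦ hu (huv.trans (not_not.1 hv)))
  refine ⟨p, q, F, H, hp, hq, hGFH, IsJoin.of_iso eF ?_, fun hH ↦ ?_⟩
  · rw [isJoin_iff]
    exact ⟨{v | Gᶜ.connectedComponentMk v = a},
      ⟨⟨x, fun h ↦ hac (hx.symm.trans h)⟩, hx⟩,
      ⟨⟨y, fun h ↦ hbc (hy.symm.trans h)⟩, fun h ↦ hab (h.symm.trans hy)⟩,
      fun u hu v hv ↦ hadj fun huv ↦ hv (huv.symm.trans hu)⟩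
  · rw [compl_compl] at eH
    exact not_isJoin_induce_supp_compl G c (IsJoin.of_iso eH.symm hH)
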